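/- arXiv:1705.06890 — 2 statements merged into one kernel-verified Lean document; each statement's English description precedes it below -/
import Mathlib

section
/- Let ψ, χ : [0,1] × ℝ → ℝ be smooth, T-periodic in t, with ψ > 0 and q := √(ψ_r² + χ_r²) > 0. Let f = f(t, ξ, p, s) be a C¹ function, T-periodic in t. Let u = u(r, t) be a C³, T-periodic radial solution of u_t = (1/(ψq)) ∂_r((ψ/q) u_r) + f(t, u, u_r, 0) on (0,1) × ℝ, with u_r(0,t) = u_r(1,t) = 0 and u_r(r,t) ≠ 0 for all (r,t) ∈ (0,1) × ℝ. Assume that (1/q) ∂_r(ψ_r/(qψ)) − q_t/q + f_p(t, u, u_r, 0) · q_r/q ≤ 0 on (0,1) × ℝ. Then for every λ ∈ ℝ and every C^{2,1} function φ = φ(r, θ, t) > 0, 2π-periodic in θ and T-periodic in t, satisfying the linearized eigenvalue problem φ_t − Δ_t φ − f_ξ(t,u,u_r,0) φ − f_p(t,u,u_r,0) φ_r − f_s(t,u,u_r,0) φ_θ = λ φ on (0,1) × ℝ × ℝ with φ_r = 0 at r ∈ {0,1}, one has λ < 0; that is, the principal eigenvalue of the linearized problem is negative and u is linearly unstable.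 -/
open Real

/-- Partial derivative of a two-variable function in the first (radial) variable. -/
noncomputable def pdr (g : ℝ → ℝ → ℝ) (r t : ℝ) : ℝ := deriv (fun s => g s t) r

/-- Partial derivative of a two-variable function in the second (time) variable. -/
noncomputable def pdt (g : ℝ → ℝ → ℝ) (r t : ℝ) : ℝ := deriv (fun s => g r s) t

/-- Partial derivative of `g(r,θ,t)` in `r`. -/
noncomputable def pdr3 (g : ℝ → ℝ → ℝ → ℝ) (r θ t : ℝ) : ℝ := deriv (fun s => g s θ t) r

/-- Partial derivative of `g(r,θ,t)` in `θ`. -/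
noncomputable def pdh3 (g : ℝ → ℝ → ℝ → ℝ) (r θ t : ℝ) : ℝ := deriv (fun s => g r s t) θ

/-- Partial derivative of `g(r,θ,t)` in `t`. -/
noncomputable def pdt3 (g : ℝ → ℝ → ℝ → ℝ) (r θ t : ℝ) : ℝ := deriv (fun s => g r θ s) t

/-- The metric coefficient `q = √(ψ_r² + χ_r²)`. -/
noncomputable def qfun (ψ χ : ℝ → ℝ → ℝ) (r t : ℝ) : ℝ :=
  Real.sqrt ((pdr ψ r t) ^ 2 + (pdr χ r t) ^ 2)

/-- The Laplace–Beltrami operator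
`Δ_t g = (1/(ψq)) ∂_r((ψ/q) ∂_r g) + (1/ψ²) ∂_θ² g` on the surface of revolution. -/
noncomputable def lapRev (ψ χ : ℝ → ℝ → ℝ) (g : ℝ → ℝ → ℝ → ℝ) (r θ t : ℝ) : ℝ :=
  (1 / (ψ r t * qfun ψ χ r t))
      * pdr3 (fun s θ' τ => (ψ s τ / qfun ψ χ s τ) * pdr3 g s θ' τ) r θ t
    + (1 / (ψ r t) ^ 2) * pdh3 (fun a b c => pdh3 g a b c) r θ t

/-- A function `φ(r,θ,t)` of class `C^{2,1}`: continuous, twice continuously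
differentiable in the space variables `(r,θ)` and differentiable in `t`. -/
def C21₃ (φ : ℝ → ℝ → ℝ → ℝ) : Prop :=
  Continuous (fun p : ℝ × ℝ × ℝ => φ p.1 p.2.1 p.2.2)
    ∧ (∀ t : ℝ, ContDiff ℝ 2 fun p : ℝ × ℝ => φ p.1 p.2 t)
    ∧ (∀ r θ : ℝ, Differentiable ℝ fun t => φ r θ t)

section AuxLemmas
open Filter Topology

lemma aux_sdt {y y' : ℝ → ℝ} {x y2 : ℝ} (hmax : IsLocalMax y x)
    (h1 : ∀ᶠ s in 𝓝 x, HasDerivAt y (y' s) s) (h2 : HasDerivAt y' y2 x) :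
    y' x = 0 ∧ y2 ≤ 0 := by
  have hx : HasDerivAt y (y' x) x := h1.self_of_nhds
  have h0 : y' x = 0 := hmax.hasDerivAt_eq_zero hx
  refine ⟨h0, ?_⟩
  by_contra hpos
  push Not at hpos
  have hd : deriv y =ᶠ[𝓝 x] y' := h1.mono fun s hs => hs.deriv
  have hdd : deriv (deriv y) x = y2 := by rw [hd.deriv_eq]; exact h2.deriv
  have hmin := isLocalMin_of_deriv_deriv_pos (f := y) (x₀ := x) (by rw [hdd]; exact hpos)
    (by rw [hx.deriv, h0]) hx.continuousAt
  have hc : ∀ᶠ s in 𝓝 x, y s = y x := by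
    filter_upwards [hmax, hmin] with s a b using le_antisymm a b
  have hc2 : ∀ᶠ s in 𝓝 x, deriv y s = 0 := by
    filter_upwards [hc.eventually_nhds] with s hs
    have : y =ᶠ[𝓝 s] fun _ => y x := hs
    rw [this.deriv_eq]; simp
  have hc3 : deriv y =ᶠ[𝓝 x] fun _ => (0:ℝ) := hc2
  have : deriv (deriv y) x = 0 := by rw [hc3.deriv_eq]; simp
  linarith

lemma aux_pdr_hasDeriv {F : ℝ → ℝ → ℝ} {r t : ℝ}
    (h : DifferentiableAt ℝ (fun p : ℝ × ℝ => F p.1 p.2) (r, t)) :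
    HasDerivAt (fun s => F s t) (fderiv ℝ (fun p : ℝ × ℝ => F p.1 p.2) (r, t) (1, 0)) r := by
  have h2 : HasDerivAt (fun s : ℝ => (s, t)) ((1:ℝ), (0:ℝ)) r :=
    (hasDerivAt_id r).prodMk (hasDerivAt_const r t)
  exact HasFDerivAt.comp_hasDerivAt (f := fun s : ℝ => (s, t)) r h.hasFDerivAt h2

lemma aux_pdt_hasDeriv {F : ℝ → ℝ → ℝ} {r t : ℝ}
    (h : DifferentiableAt ℝ (fun p : ℝ × ℝ => F p.1 p.2) (r, t)) :
    HasDerivAt (fun s => F r s) (fderiv ℝ (fun p : ℝ × ℝ => F p.1 p.2) (r, t) (0, 1)) t := by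
  have h2 : HasDerivAt (fun s : ℝ => (r, s)) ((0:ℝ), (1:ℝ)) t :=
    (hasDerivAt_const t r).prodMk (hasDerivAt_id t)
  exact HasFDerivAt.comp_hasDerivAt (f := fun s : ℝ => (r, s)) t h.hasFDerivAt h2

lemma aux_r {F : ℝ → ℝ → ℝ} {r t : ℝ}
    (h : DifferentiableAt ℝ (fun p : ℝ × ℝ => F p.1 p.2) (r, t)) :
    HasDerivAt (fun s => F s t) (pdr F r t) r :=
  (aux_pdr_hasDeriv h).differentiableAt.hasDerivAt

lemma aux_t {F : ℝ → ℝ → ℝ} {r t : ℝ}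
    (h : DifferentiableAt ℝ (fun p : ℝ × ℝ => F p.1 p.2) (r, t)) :
    HasDerivAt (fun s => F r s) (pdt F r t) t :=
  (aux_pdt_hasDeriv h).differentiableAt.hasDerivAt

lemma aux_ev_diff {F : ℝ → ℝ → ℝ} {p : ℝ × ℝ} {n : WithTop ℕ∞}
    (h : ContDiffAt ℝ n (fun p : ℝ × ℝ => F p.1 p.2) p) (hn : 1 ≤ n) :
    ∀ᶠ z in 𝓝 p, DifferentiableAt ℝ (fun p : ℝ × ℝ => F p.1 p.2) z := by
  have h1 : ContDiffAt ℝ 1 (fun p : ℝ × ℝ => F p.1 p.2) p := h.of_le hn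
  filter_upwards [h1.eventually (by simp)] with z hz
  exact hz.differentiableAt (by simp)

lemma aux_pdr_cda {F : ℝ → ℝ → ℝ} {p : ℝ × ℝ} {m n : WithTop ℕ∞}
    (h : ContDiffAt ℝ n (fun p : ℝ × ℝ => F p.1 p.2) p) (hmn : m + 1 ≤ n) :
    ContDiffAt ℝ m (fun p : ℝ × ℝ => pdr F p.1 p.2) p := by
  have h1 := (h.fderiv_right hmn).clm_apply (contDiffAt_const (c := ((1:ℝ), (0:ℝ))))
  refine h1.congr_of_eventuallyEq ?_
  filter_upwards [aux_ev_diff h (le_trans le_add_self hmn)] with z hz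
  exact (aux_pdr_hasDeriv (r := z.1) (t := z.2) hz).deriv

lemma aux_pdt_cda {F : ℝ → ℝ → ℝ} {p : ℝ × ℝ} {m n : WithTop ℕ∞}
    (h : ContDiffAt ℝ n (fun p : ℝ × ℝ => F p.1 p.2) p) (hmn : m + 1 ≤ n) :
    ContDiffAt ℝ m (fun p : ℝ × ℝ => pdt F p.1 p.2) p := by
  have h1 := (h.fderiv_right hmn).clm_apply (contDiffAt_const (c := ((0:ℝ), (1:ℝ))))
  refine h1.congr_of_eventuallyEq ?_
  filter_upwards [aux_ev_diff h (le_trans le_add_self hmn)] with z hz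
  exact (aux_pdt_hasDeriv (r := z.1) (t := z.2) hz).deriv

lemma aux_comm {F : ℝ → ℝ → ℝ} (h : ContDiff ℝ 3 (fun p : ℝ × ℝ => F p.1 p.2)) (r t : ℝ) :
    pdr (pdt F) r t = pdt (pdr F) r t := by
  have hd : ∀ z, DifferentiableAt ℝ (fun p : ℝ × ℝ => F p.1 p.2) z := fun z =>
    h.contDiffAt.differentiableAt (by simp)
  have e1 : pdt F = fun r t => fderiv ℝ (fun p : ℝ × ℝ => F p.1 p.2) (r, t) (0, 1) := by
    ext r t; exact (aux_pdt_hasDeriv (hd _)).deriv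
  have e2 : pdr F = fun r t => fderiv ℝ (fun p : ℝ × ℝ => F p.1 p.2) (r, t) (1, 0) := by
    ext r t; exact (aux_pdr_hasDeriv (hd _)).deriv
  have hf2 : DifferentiableAt ℝ (fderiv ℝ (fun p : ℝ × ℝ => F p.1 p.2)) (r, t) :=
    (h.contDiffAt.fderiv_right (m := 2) (by norm_num)).differentiableAt (by simp)
  have hv : ∀ v : ℝ × ℝ, HasFDerivAt (fun z : ℝ × ℝ => fderiv ℝ (fun p : ℝ × ℝ => F p.1 p.2) z v)
      ((fderiv ℝ (fderiv ℝ (fun p : ℝ × ℝ => F p.1 p.2)) (r, t)).flip v) (r, t) := by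
    intro v
    have := hf2.hasFDerivAt.clm_apply (hasFDerivAt_const v (r, t))
    simpa using this
  have hs : IsSymmSndFDerivAt ℝ (fun p : ℝ × ℝ => F p.1 p.2) (r, t) :=
    h.contDiffAt.isSymmSndFDerivAt (by simp; norm_num)
  have a1 := (aux_pdr_hasDeriv (F := pdt F) (r := r) (t := t)
    (by rw [e1]; exact (hv _).differentiableAt)).deriv
  have a2 := (aux_pdt_hasDeriv (F := pdr F) (r := r) (t := t)
    (by rw [e2]; exact (hv _).differentiableAt)).deriv
  have b1 : pdr (pdt F) r t = _ := a1
  have b2 : pdt (pdr F) r t = _ := a2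
  rw [b1, b2, e1, e2]
  simp only [Prod.mk.eta]
  rw [(hv (0,1)).fderiv, (hv (1,0)).fderiv]
  simp only [ContinuousLinearMap.flip_apply]
  exact hs _ _

lemma aux_q_cda {ψ χ : ℝ → ℝ → ℝ}
    (hψ : ContDiff ℝ (⊤ : ℕ∞) fun p : ℝ × ℝ => ψ p.1 p.2)
    (hχ : ContDiff ℝ (⊤ : ℕ∞) fun p : ℝ × ℝ => χ p.1 p.2) {r t : ℝ}
    (hq : 0 < qfun ψ χ r t) :
    ContDiffAt ℝ 3 (fun p : ℝ × ℝ => qfun ψ χ p.1 p.2) (r, t) := by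
  have h1 : ContDiffAt ℝ 3 (fun p : ℝ × ℝ => pdr ψ p.1 p.2) (r, t) :=
    aux_pdr_cda (n := 4) (hψ.contDiffAt.of_le (WithTop.coe_le_coe.2 (le_top : (4:ℕ∞) ≤ ⊤))) (by norm_num)
  have h2 : ContDiffAt ℝ 3 (fun p : ℝ × ℝ => pdr χ p.1 p.2) (r, t) :=
    aux_pdr_cda (n := 4) (hχ.contDiffAt.of_le (WithTop.coe_le_coe.2 (le_top : (4:ℕ∞) ≤ ⊤))) (by norm_num)
  have hne : (pdr ψ r t) ^ 2 + (pdr χ r t) ^ 2 ≠ 0 := (Real.sqrt_pos.mp hq).ne'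
  exact ((h1.pow 2).add (h2.pow 2)).sqrt hne

lemma aux_f {f : ℝ → ℝ → ℝ → ℝ → ℝ}
    (hf : ContDiff ℝ 1 fun p : ℝ × ℝ × ℝ × ℝ => f p.1 p.2.1 p.2.2.1 p.2.2.2)
    {a b : ℝ → ℝ} {a' b' r t : ℝ} (ha : HasDerivAt a a' r) (hb : HasDerivAt b b' r) :
    HasDerivAt (fun s => f t (a s) (b s) 0)
      (deriv (fun ξ => f t ξ (b r) 0) (a r) * a' + deriv (fun p => f t (a r) p 0) (b r) * b') r := by
  set G : ℝ × ℝ × ℝ × ℝ → ℝ := fun p => f p.1 p.2.1 p.2.2.1 p.2.2.2 with hG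
  have hD : HasFDerivAt G (fderiv ℝ G (t, a r, b r, 0)) (t, a r, b r, 0) :=
    (hf.contDiffAt.differentiableAt (by simp)).hasFDerivAt
  have key : ∀ (α β : ℝ → ℝ) (α' β' x : ℝ), HasDerivAt α α' x → HasDerivAt β β' x →
      α x = a r → β x = b r →
      HasDerivAt (fun s => f t (α s) (β s) 0) (fderiv ℝ G (t, a r, b r, 0) (0, α', β', 0)) x := by
    intro α β α' β' x h1 h2 e1 e2
    have h3 : HasDerivAt (fun s : ℝ => (t, α s, β s, (0:ℝ))) ((0:ℝ), α', β', (0:ℝ)) x :=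
      (hasDerivAt_const x t).prodMk (h1.prodMk (h2.prodMk (hasDerivAt_const x 0)))
    rw [← e1, ← e2] at hD ⊢
    exact HasFDerivAt.comp_hasDerivAt (f := fun s : ℝ => (t, α s, β s, (0:ℝ))) x hD h3
  have k1 := (key id (fun _ => b r) 1 0 (a r) (hasDerivAt_id _) (hasDerivAt_const _ _) rfl rfl).deriv
  have k2 := (key (fun _ => a r) id 0 1 (b r) (hasDerivAt_const _ _) (hasDerivAt_id _) rfl rfl).deriv
  have k3 := key a b a' b' r ha hb rfl rfl
  convert k3 using 1
  simp only [id] at k1 k2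
  rw [k1, k2]
  have : ((0:ℝ), a', b', (0:ℝ)) = a' • ((0:ℝ), (1:ℝ), (0:ℝ), (0:ℝ)) + b' • ((0:ℝ), (0:ℝ), (1:ℝ), (0:ℝ)) := by
    simp
  rw [this, map_add, map_smul, map_smul]
  simp only [smul_eq_mul]; ring

lemma aux_fp_cont {f : ℝ → ℝ → ℝ → ℝ → ℝ}
    (hf : ContDiff ℝ 1 fun p : ℝ × ℝ × ℝ × ℝ => f p.1 p.2.1 p.2.2.1 p.2.2.2)
    {u v : ℝ → ℝ → ℝ} (hu : Continuous fun p : ℝ × ℝ => u p.1 p.2)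
    (hv : Continuous fun p : ℝ × ℝ => v p.1 p.2) :
    Continuous fun p : ℝ × ℝ => deriv (fun z => f p.2 (u p.1 p.2) z 0) (v p.1 p.2) := by
  set G : ℝ × ℝ × ℝ × ℝ → ℝ := fun p => f p.1 p.2.1 p.2.2.1 p.2.2.2 with hG
  have : (fun p : ℝ × ℝ => deriv (fun z => f p.2 (u p.1 p.2) z 0) (v p.1 p.2)) =
      fun p : ℝ × ℝ => fderiv ℝ G (p.2, u p.1 p.2, v p.1 p.2, 0) (0, 0, 1, 0) := by
    ext p
    have hD : HasFDerivAt G (fderiv ℝ G (p.2, u p.1 p.2, v p.1 p.2, 0))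
      (p.2, u p.1 p.2, v p.1 p.2, 0) :=
      (hf.contDiffAt.differentiableAt (by simp)).hasFDerivAt
    have h3 : HasDerivAt (fun s : ℝ => (p.2, u p.1 p.2, s, (0:ℝ))) ((0:ℝ), (0:ℝ), (1:ℝ), (0:ℝ))
        (v p.1 p.2) :=
      (hasDerivAt_const _ _).prodMk ((hasDerivAt_const _ _).prodMk
        ((hasDerivAt_id _).prodMk (hasDerivAt_const _ 0)))
    exact (HasFDerivAt.comp_hasDerivAt (f := fun s : ℝ => (p.2, u p.1 p.2, s, (0:ℝ))) _ hD h3).deriv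
  rw [this]
  have hc : Continuous (fderiv ℝ G) := hf.continuous_fderiv (by simp)
  exact (hc.comp (continuous_snd.prodMk (hu.prodMk (hv.prodMk continuous_const)))).clm_apply
    continuous_const

lemma aux_alg (ψ q ψr qr qt w wr wt wrr B Br fx fp : ℝ) (hψ : 0 < ψ) (hq : 0 < q)
    (hB : B = ψr / (q * ψ))
    (h : qt * w + q * wt = Br * w + B * wr + (wrr * q - wr * qr) / q ^ 2
      + (fx * (q * w) + fp * (qr * w + q * wr))) :
    wt = (1 / (ψ * q)) * ((ψr * q - ψ * qr) / q ^ 2 * wr + ψ / q * wrr) + fx * w + fp * wr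
      + ((1 / q) * Br - qt / q + fp * qr / q) * w := by
  have hwt : wt = (Br * w + B * wr + (wrr * q - wr * qr) / q ^ 2
      + (fx * (q * w) + fp * (qr * w + q * wr)) - qt * w) / q := by
    rw [eq_div_iff hq.ne']
    linarith
  rw [hwt, hB]
  field_simp
  ring

lemma aux_w {ψ χ : ℝ → ℝ → ℝ}
    (hψ : ContDiff ℝ (⊤ : ℕ∞) fun p : ℝ × ℝ => ψ p.1 p.2)
    (hχ : ContDiff ℝ (⊤ : ℕ∞) fun p : ℝ × ℝ => χ p.1 p.2)
    (hψpos : ∀ r ∈ Set.Icc (0:ℝ) 1, ∀ t : ℝ, 0 < ψ r t)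
    (hqpos : ∀ r ∈ Set.Icc (0:ℝ) 1, ∀ t : ℝ, 0 < qfun ψ χ r t)
    {f : ℝ → ℝ → ℝ → ℝ → ℝ}
    (hf : ContDiff ℝ 1 fun p : ℝ × ℝ × ℝ × ℝ => f p.1 p.2.1 p.2.2.1 p.2.2.2)
    {u : ℝ → ℝ → ℝ}
    (hu : ContDiff ℝ 3 fun p : ℝ × ℝ => u p.1 p.2)
    (hPDE : ∀ r ∈ Set.Ioo (0:ℝ) 1, ∀ t : ℝ,
      pdt u r t
        = (1 / (ψ r t * qfun ψ χ r t))
            * pdr (fun s τ => (ψ s τ / qfun ψ χ s τ) * pdr u s τ) r t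
          + f t (u r t) (pdr u r t) 0)
    (r : ℝ) (hr : r ∈ Set.Ioo (0:ℝ) 1) (t : ℝ) (w : ℝ → ℝ → ℝ)
    (hw : w = fun r t => pdr u r t / qfun ψ χ r t) :
    pdt w r t = (1 / (ψ r t * qfun ψ χ r t)) *
        (pdr (fun s τ => ψ s τ / qfun ψ χ s τ) r t * pdr w r t
          + ψ r t / qfun ψ χ r t * pdr (pdr w) r t)
      + deriv (fun ξ => f t ξ (pdr u r t) 0) (u r t) * w r t
      + deriv (fun p => f t (u r t) p 0) (pdr u r t) * pdr w r t
      + ((1 / qfun ψ χ r t) * pdr (fun s τ => pdr ψ s τ / (qfun ψ χ s τ * ψ s τ)) r t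
          - pdt (qfun ψ χ) r t / qfun ψ χ r t
          + deriv (fun p => f t (u r t) p 0) (pdr u r t)
              * pdr (qfun ψ χ) r t / qfun ψ χ r t) * w r t := by
  set q := qfun ψ χ with hqdef
  have hIcc : ∀ s ∈ Set.Ioo (0:ℝ) 1, s ∈ Set.Icc (0:ℝ) 1 := fun s hs => Set.Ioo_subset_Icc_self hs
  have cq : ∀ s ∈ Set.Ioo (0:ℝ) 1, ∀ t, ContDiffAt ℝ 3 (fun p : ℝ × ℝ => q p.1 p.2) (s, t) :=
    fun s hs t => aux_q_cda hψ hχ (hqpos s (hIcc s hs) t)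
  have cψ : ∀ z, ContDiffAt ℝ 4 (fun p : ℝ × ℝ => ψ p.1 p.2) z := fun z =>
    hψ.contDiffAt.of_le (WithTop.coe_le_coe.2 (le_top : (4:ℕ∞) ≤ ⊤))
  have cψr : ∀ z, ContDiffAt ℝ 3 (fun p : ℝ × ℝ => pdr ψ p.1 p.2) z := fun z =>
    aux_pdr_cda (cψ z) (by norm_num)
  have cur : ∀ z, ContDiffAt ℝ 2 (fun p : ℝ × ℝ => pdr u p.1 p.2) z := fun z =>
    aux_pdr_cda hu.contDiffAt (by norm_num)
  have qne : ∀ s ∈ Set.Ioo (0:ℝ) 1, ∀ t, q s t ≠ 0 := fun s hs t => (hqpos s (hIcc s hs) t).ne'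
  have ψne : ∀ s ∈ Set.Ioo (0:ℝ) 1, ∀ t, ψ s t ≠ 0 := fun s hs t => (hψpos s (hIcc s hs) t).ne'
  have cw : ∀ s ∈ Set.Ioo (0:ℝ) 1, ∀ t, ContDiffAt ℝ 2 (fun p : ℝ × ℝ => w p.1 p.2) (s, t) := by
    intro s hs t
    rw [hw]
    exact (cur _).div ((cq s hs t).of_le (by norm_num)) (qne s hs t)
  have dq : ∀ s ∈ Set.Ioo (0:ℝ) 1, ∀ t, HasDerivAt (fun x => q x t) (pdr q s t) s :=
    fun s hs t => aux_r ((cq s hs t).differentiableAt (by simp))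
  have dψ : ∀ s t, HasDerivAt (fun x => ψ x t) (pdr ψ s t) s :=
    fun s t => aux_r ((cψ (s,t)).differentiableAt (by simp))
  have dw : ∀ s ∈ Set.Ioo (0:ℝ) 1, ∀ t, HasDerivAt (fun x => w x t) (pdr w s t) s :=
    fun s hs t => aux_r ((cw s hs t).differentiableAt (by simp))
  have dwr : HasDerivAt (fun x => pdr w x t) (pdr (pdr w) r t) r :=
    aux_r ((aux_pdr_cda (cw r hr t) (m := 1) (by norm_num)).differentiableAt (by simp))
  set B : ℝ → ℝ → ℝ := fun s τ => pdr ψ s τ / (q s τ * ψ s τ) with hB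
  have dB : HasDerivAt (fun x => B x t) (pdr B r t) r := by
    refine aux_r (F := B) ?_
    have hm : ContDiffAt ℝ 3 (fun p : ℝ × ℝ => q p.1 p.2 * ψ p.1 p.2) (r, t) :=
      (cq r hr t).mul ((cψ _).of_le (by norm_num))
    have hd : ContDiffAt ℝ 3 (fun p : ℝ × ℝ => pdr ψ p.1 p.2 / (q p.1 p.2 * ψ p.1 p.2)) (r, t) :=
      (cψr _).div hm (mul_ne_zero (qne r hr t) (ψne r hr t))
    exact hd.differentiableAt (by simp)
  have hnear : ∀ᶠ s in 𝓝 r, s ∈ Set.Ioo (0:ℝ) 1 := isOpen_Ioo.mem_nhds hr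
  -- the equation in terms of w
  have hEq : ∀ s ∈ Set.Ioo (0:ℝ) 1,
      pdt u s t = B s t * w s t + pdr w s t / q s t + f t (u s t) (pdr u s t) 0 := by
    intro s hs
    rw [hPDE s hs t]
    have e : (fun s τ => (ψ s τ / q s τ) * pdr u s τ) = fun s τ => ψ s τ * w s τ := by
      rw [hw]; ext a b; ring
    rw [e]
    have e2 : pdr (fun s τ => ψ s τ * w s τ) s t = pdr ψ s t * w s t + ψ s t * pdr w s t :=
      ((dψ s t).mul (dw s hs t)).deriv
    rw [e2, hB]
    have := qne s hs t
    have := ψne s hs t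
    field_simp
  have dur : HasDerivAt (fun x => pdr u x t) (pdr (pdr u) r t) r :=
    aux_r ((cur (r,t)).differentiableAt (by simp))
  have du : HasDerivAt (fun x => u x t) (pdr u r t) r :=
    aux_r (hu.contDiffAt.differentiableAt (by simp))
  have hR := ((dB.mul (dw r hr t)).add (dwr.div (dq r hr t) (qne r hr t))).add (aux_f hf (t := t) du dur)
  have hL : HasDerivAt (fun x => pdt u x t) _ r :=
    hR.congr_of_eventuallyEq (hnear.mono fun s hs => hEq s hs)
  have hL' : pdr (pdt u) r t = _ := hL.deriv
  rw [aux_comm hu] at hL'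
  -- u_r = q w
  have urq : ∀ s ∈ Set.Ioo (0:ℝ) 1, ∀ t, pdr u s t = q s t * w s t := by
    intro s hs t
    rw [hw]; have := qne s hs t; field_simp
  have eurt : pdt (pdr u) r t = pdt q r t * w r t + q r t * pdt w r t := by
    have h1 := (aux_t ((cq r hr t).differentiableAt (by simp))).mul
      (aux_t ((cw r hr t).differentiableAt (by simp)))
    have h2 : (fun s => pdr u r s) = fun s => q r s * w r s := by
      ext s; exact urq r hr s
    unfold pdt at h1 ⊢
    rw [h2]; exact h1.deriv
  have eurr : pdr (pdr u) r t = pdr q r t * w r t + q r t * pdr w r t := by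
    have h1 := (dq r hr t).mul (dw r hr t)
    exact (h1.congr_of_eventuallyEq (hnear.mono fun s hs => urq s hs t)).deriv
  have eA : pdr (fun s τ => ψ s τ / q s τ) r t
      = (pdr ψ r t * q r t - ψ r t * pdr q r t) / (q r t) ^ 2 :=
    ((dψ r t).div (dq r hr t) (qne r hr t)).deriv
  rw [eA]
  refine aux_alg _ _ _ _ _ _ _ _ _ (B r t) _ _ _ (hψpos r (hIcc r hr) t) (hqpos r (hIcc r hr) t) rfl ?_
  rw [← eurt, hL', ← eurr, ← urq r hr t]

lemma aux_final (ψ q A A' w wr wt wrr H fx fp fs φ φr φt φrr φh φhh m E α lam C1 C2 c : ℝ)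
    (hψ : 0 < ψ) (hq : 0 < q) (hA : A = ψ / q) (hφ : 0 < φ) (hm : 0 < m) (hE : 0 < E)
    (hα : 0 < α) (hc : 0 < c) (hH : H ≤ 0) (hlam : 0 ≤ lam)
    (hw : wt = (1 / (ψ * q)) * (A' * wr + A * wrr) + fx * w + fp * wr + H * w)
    (hp : φt - ((1 / (ψ * q)) * (A' * φr + A * φrr) + (1 / ψ ^ 2) * φhh) - fx * φ - fp * φr
      - fs * φh = lam * φ)
    (h0 : w = m * φ) (ht : wt = m * φt) (hh : φh = 0) (hhh : 0 ≤ φhh)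
    (h1 : wr - (-(E * α) * φ + m * φr) = 0)
    (h2 : wrr - (-(E * α * α) * φ + 2 * (-(E * α) * φr) + m * φrr) ≤ 0)
    (hwc : c ≤ w) (hC1 : |q * A' / ψ + q ^ 2 * fp| ≤ C1) (hC2 : |wr| ≤ C2)
    (hbig : C1 + 2 * C2 / c < α) : False := by
  have hφt : φt = ((1 / (ψ * q)) * (A' * φr + A * φrr) + (1 / ψ ^ 2) * φhh) + fx * φ + fp * φr
      + lam * φ := by rw [hh] at hp; linarith
  have hwr : wr = -(E * α) * φ + m * φr := by linarith
  -- lower bound for phi_r / phi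
  have hφr : -(C2 / c) * φ ≤ φr := by
    have e : m * φr = wr + E * α * φ := by linarith
    have p1 : 0 ≤ E * α * φ := by positivity
    have p2 : -C2 ≤ wr := (abs_le.mp hC2).1
    have hC2n : 0 ≤ C2 := le_trans (abs_nonneg _) hC2
    have p3 : C2 ≤ C2 / c * w := by
      rw [div_mul_eq_mul_div, le_div_iff₀ hc]; nlinarith
    have p4 : m * (-(C2 / c) * φ) ≤ m * φr := by
      rw [e]
      have : m * (-(C2 / c) * φ) = -(C2 / c * w) := by rw [h0]; ring
      linarith
    exact le_of_mul_le_mul_left p4 hm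
  have hmain : 0 = (1 / (ψ * q)) * (A' * (wr - m * φr) + A * (wrr - m * φrr))
      - m * ((1 / ψ ^ 2) * φhh) + fp * (wr - m * φr) + H * w - lam * (m * φ) := by
    have := ht
    rw [hw, hφt, h0] at this
    rw [h0]
    linarith
  have s1 : 0 ≤ m * ((1 / ψ ^ 2) * φhh) := by positivity
  have s2 : H * w ≤ 0 := mul_nonpos_of_nonpos_of_nonneg hH (by linarith)
  have s3 : 0 ≤ lam * (m * φ) := by positivity
  have hAeq : (1 / (ψ * q)) * A = 1 / q ^ 2 := by rw [hA]; field_simp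
  have s4 : (1 / q ^ 2) * (wrr - m * φrr) ≤ (1 / q ^ 2) * (-(E * α * α) * φ + 2 * (-(E * α) * φr)) := by
    apply mul_le_mul_of_nonneg_left _ (by positivity)
    linarith
  have e5 : wr - m * φr = -(E * α) * φ := by linarith
  rw [e5, mul_add, ← mul_assoc _ A, hAeq] at hmain
  have s6 : 0 ≤ (1 / (ψ * q)) * (A' * (-(E * α) * φ)) +
     (1 / q ^ 2) * (-(E * α * α) * φ + 2 * (-(E * α) * φr)) + fp * (-(E * α) * φ) := by linarith
  have e7 : (1 / (ψ * q)) * (A' * (-(E * α) * φ)) +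
     (1 / q ^ 2) * (-(E * α * α) * φ + 2 * (-(E * α) * φr)) + fp * (-(E * α) * φ)
     = -(E * α / q ^ 2) * ((q * A' / ψ + q ^ 2 * fp) * φ + α * φ + 2 * φr) := by
    field_simp
    ring
  rw [e7] at s6
  have p : 0 < E * α / q ^ 2 := by positivity
  have s8 : 0 < (q * A' / ψ + q ^ 2 * fp) * φ + α * φ + 2 * φr := by
    have a1 := (abs_le.mp hC1).1
    have a2 : -C1 * φ ≤ (q * A' / ψ + q ^ 2 * fp) * φ := mul_le_mul_of_nonneg_right a1 hφ.le
    have a3 : (C1 + 2 * C2 / c) * φ < α * φ := mul_lt_mul_of_pos_right hbig hφ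
    have a4 : 2 * C2 / c = 2 * (C2 / c) := by ring
    rw [a4, add_mul] at a3
    linarith
  have := mul_pos p s8
  linarith

end AuxLemmas

/-- Theorem 3.1 of the paper: let `u(r,t)` be a radial `T`-periodic
solution with `u_r ≠ 0` of the reaction-diffusion equation on the evolving surface of
revolution, `f` independent of `r`, and assume
`(1/q)∂_r(ψ_r/(qψ)) − q_t/q + f_p(t,u,u_r,0) q_r/q ≤ 0`. Then the principal
eigenvalue of the linearized problem is negative: every `T`-periodic positive
eigenfunction has eigenvalue `λ < 0`, i.e. `u` is unstable. -/
theorem stmt_4 (T : ℝ) (hT : 0 < T) (ψ χ : ℝ → ℝ → ℝ)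
    (hψ : ContDiff ℝ (⊤ : ℕ∞) fun p : ℝ × ℝ => ψ p.1 p.2)
    (hχ : ContDiff ℝ (⊤ : ℕ∞) fun p : ℝ × ℝ => χ p.1 p.2)
    (hψper : ∀ r t : ℝ, ψ r (t + T) = ψ r t) (hχper : ∀ r t : ℝ, χ r (t + T) = χ r t)
    (hψpos : ∀ r ∈ Set.Icc (0:ℝ) 1, ∀ t : ℝ, 0 < ψ r t)
    (hqpos : ∀ r ∈ Set.Icc (0:ℝ) 1, ∀ t : ℝ, 0 < qfun ψ χ r t)
    (f : ℝ → ℝ → ℝ → ℝ → ℝ)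
    (hf : ContDiff ℝ 1 fun p : ℝ × ℝ × ℝ × ℝ => f p.1 p.2.1 p.2.2.1 p.2.2.2)
    (hfper : ∀ t ξ p s : ℝ, f (t + T) ξ p s = f t ξ p s)
    (u : ℝ → ℝ → ℝ)
    (hu : ContDiff ℝ 3 fun p : ℝ × ℝ => u p.1 p.2)
    (huper : ∀ r t : ℝ, u r (t + T) = u r t)
    (hPDE : ∀ r ∈ Set.Ioo (0:ℝ) 1, ∀ t : ℝ,
      pdt u r t
        = (1 / (ψ r t * qfun ψ χ r t))
            * pdr (fun s τ => (ψ s τ / qfun ψ χ s τ) * pdr u s τ) r t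
          + f t (u r t) (pdr u r t) 0)
    (hNeu : ∀ t : ℝ, pdr u 0 t = 0 ∧ pdr u 1 t = 0)
    (hur : ∀ r ∈ Set.Ioo (0:ℝ) 1, ∀ t : ℝ, pdr u r t ≠ 0)
    (hcond : ∀ r ∈ Set.Ioo (0:ℝ) 1, ∀ t : ℝ,
      (1 / qfun ψ χ r t) * pdr (fun s τ => pdr ψ s τ / (qfun ψ χ s τ * ψ s τ)) r t
          - pdt (qfun ψ χ) r t / qfun ψ χ r t
          + deriv (fun p => f t (u r t) p 0) (pdr u r t)
              * pdr (qfun ψ χ) r t / qfun ψ χ r t ≤ 0) :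
    ∀ (lam : ℝ) (φ : ℝ → ℝ → ℝ → ℝ),
      C21₃ φ →
      (∀ r ∈ Set.Icc (0:ℝ) 1, ∀ θ t : ℝ, 0 < φ r θ t) →
      (∀ r θ t : ℝ, φ r (θ + 2 * π) t = φ r θ t) →
      (∀ r θ t : ℝ, φ r θ (t + T) = φ r θ t) →
      (∀ r ∈ Set.Ioo (0:ℝ) 1, ∀ θ t : ℝ,
        pdt3 φ r θ t - lapRev ψ χ φ r θ t
            - deriv (fun ξ => f t ξ (pdr u r t) 0) (u r t) * φ r θ t
            - deriv (fun p => f t (u r t) p 0) (pdr u r t) * pdr3 φ r θ t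
            - deriv (fun s => f t (u r t) (pdr u r t) s) 0 * pdh3 φ r θ t
          = lam * φ r θ t) →
      (∀ θ t : ℝ, pdr3 φ 0 θ t = 0 ∧ pdr3 φ 1 θ t = 0) →
      lam < 0 := by
  intro lam φ hC hφpos hφ2π hφT hEig hφN
  obtain ⟨hφc, hφ2, hφt⟩ := hC
  by_contra hlam
  push Not at hlam
  have hIcc : ∀ s ∈ Set.Ioo (0:ℝ) 1, s ∈ Set.Icc (0:ℝ) 1 := fun s hs => Set.Ioo_subset_Icc_self hs
  have hcq : ∀ s ∈ Set.Icc (0:ℝ) 1, ∀ t,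
      ContDiffAt ℝ 3 (fun p : ℝ × ℝ => qfun ψ χ p.1 p.2) (s, t) :=
    fun s hs t => aux_q_cda hψ hχ (hqpos s hs t)
  have hIdent := aux_w hψ hχ hψpos hqpos hf hu hPDE
  have hqne : ∀ s ∈ Set.Icc (0:ℝ) 1, ∀ t, qfun ψ χ s t ≠ 0 := fun s hs t => (hqpos s hs t).ne'
  have cψ : ∀ z, ContDiffAt ℝ 4 (fun p : ℝ × ℝ => ψ p.1 p.2) z := fun z =>
    hψ.contDiffAt.of_le (WithTop.coe_le_coe.2 (le_top : (4:ℕ∞) ≤ ⊤))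
  have hqper : ∀ r t, qfun ψ χ r (t + T) = qfun ψ χ r t := by
    intro r t
    have h1 : pdr ψ r (t + T) = pdr ψ r t := by unfold pdr; simp only [hψper]
    have h2 : pdr χ r (t + T) = pdr χ r t := by unfold pdr; simp only [hχper]
    unfold qfun; rw [h1, h2]
  set q := qfun ψ χ with hqdef
  have cur : ∀ z, ContDiffAt ℝ 2 (fun p : ℝ × ℝ => pdr u p.1 p.2) z := fun z =>
    aux_pdr_cda hu.contDiffAt (by norm_num)
  have hurper : ∀ r t, pdr u r (t + T) = pdr u r t := by
    intro r t; unfold pdr; simp only [huper]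
  -- w and W
  obtain ⟨w, hw⟩ : ∃ w : ℝ → ℝ → ℝ, w = fun r t => pdr u r t / q r t := ⟨_, rfl⟩
  have cw : ∀ s ∈ Set.Icc (0:ℝ) 1, ∀ t, ContDiffAt ℝ 2 (fun p : ℝ × ℝ => w p.1 p.2) (s, t) := by
    intro s hs t
    rw [hw]
    exact (cur _).div ((hcq s hs t).of_le (by norm_num)) (hqne s hs t)
  obtain ⟨σ, hσ⟩ : ∃ σ : ℝ, σ = pdr u (1/2) 0 := ⟨_, rfl⟩
  have hhalf : (1/2:ℝ) ∈ Set.Ioo (0:ℝ) 1 := by norm_num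
  have hσne : σ ≠ 0 := by rw [hσ]; exact hur _ hhalf 0
  obtain ⟨W, hW⟩ : ∃ W : ℝ → ℝ → ℝ, W = fun r t => σ * w r t := ⟨_, rfl⟩
  have cW : ∀ s ∈ Set.Icc (0:ℝ) 1, ∀ t, ContDiffAt ℝ 2 (fun p : ℝ × ℝ => W p.1 p.2) (s, t) := by
    intro s hs t
    rw [hW]
    exact contDiffAt_const.mul (cw s hs t)
  have hWr : pdr W = fun r t => σ * pdr w r t := by
    rw [hW]; ext r t; unfold pdr; exact deriv_const_mul_field σ
  have hWt : pdt W = fun r t => σ * pdt w r t := by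
    rw [hW]; ext r t; unfold pdt; exact deriv_const_mul_field σ
  have hWrr : pdr (pdr W) = fun r t => σ * pdr (pdr w) r t := by
    rw [hWr]; ext r t; exact deriv_const_mul_field σ
  have hWper : ∀ r t, W r (t + T) = W r t := by
    intro r t; rw [hW, hw]; simp only [hurper, hqper]
  have hW0 : ∀ t, W 0 t = 0 := by intro t; rw [hW, hw]; simp [(hNeu t).1]
  have hW1 : ∀ t, W 1 t = 0 := by intro t; rw [hW, hw]; simp [(hNeu t).2]
  have hWhalf : 0 < W (1/2) 0 := by
    rw [hW, hw]
    show 0 < σ * (pdr u (1/2) 0 / q (1/2) 0)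
    rw [← hσ, ← mul_div_assoc]
    exact div_pos (mul_self_pos.mpr hσne) (hqpos _ (hIcc _ hhalf) 0)
  -- bounds
  set S : Set (ℝ × ℝ) := Set.Icc (0:ℝ) 1 ×ˢ Set.Icc (0:ℝ) T with hS
  have hScomp : IsCompact S := isCompact_Icc.prod isCompact_Icc
  obtain ⟨C1, hC1⟩ : ∃ C, ∀ z ∈ S, ‖q z.1 z.2 * pdr (fun s τ => ψ s τ / q s τ) z.1 z.2 / ψ z.1 z.2
      + (q z.1 z.2) ^ 2 * deriv (fun p => f z.2 (u z.1 z.2) p 0) (pdr u z.1 z.2)‖ ≤ C := by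
    apply hScomp.exists_bound_of_continuousOn
    rintro ⟨r, t⟩ hz
    have hr := hz.1
    apply ContinuousAt.continuousWithinAt
    have c1 := (hcq r hr t).continuousAt
    have c2 : ContinuousAt (fun z : ℝ × ℝ => pdr (fun s τ => ψ s τ / q s τ) z.1 z.2) (r, t) := by
      have : ContDiffAt ℝ 3 (fun p : ℝ × ℝ => ψ p.1 p.2 / q p.1 p.2) (r, t) :=
        ((cψ _).of_le (by norm_num)).div (hcq r hr t) (hqne r hr t)
      exact (aux_pdr_cda (F := fun s τ => ψ s τ / q s τ) (m := 0) this (by norm_num)).continuousAt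
    have c3 := (cψ (r, t)).continuousAt
    have c4 := (aux_fp_cont hf hu.continuous
      (continuous_iff_continuousAt.mpr fun z => (cur z).continuousAt)).continuousAt (x := (r, t))
    exact ((c1.mul c2).div c3 (hψpos r hr t).ne').add ((c1.pow 2).mul c4)
  obtain ⟨C2, hC2⟩ : ∃ C, ∀ z ∈ S, ‖pdr W z.1 z.2‖ ≤ C := by
    apply hScomp.exists_bound_of_continuousOn
    rintro ⟨r, t⟩ hz
    exact (aux_pdr_cda (m := 0) (cW r hz.1 t) (by norm_num)).continuousAt.continuousWithinAt
  set K : Set (ℝ × ℝ × ℝ) := Set.Icc (0:ℝ) 1 ×ˢ (Set.Icc (0:ℝ) (2*π) ×ˢ Set.Icc (0:ℝ) T) with hK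
  have hKcomp : IsCompact K := isCompact_Icc.prod (isCompact_Icc.prod isCompact_Icc)
  have hKmem : ((1/2:ℝ), (0:ℝ), (0:ℝ)) ∈ K :=
    ⟨hIcc _ hhalf, ⟨le_rfl, by positivity⟩, ⟨le_rfl, hT.le⟩⟩
  obtain ⟨zm, hzm, hzmin⟩ := hKcomp.exists_isMinOn ⟨_, hKmem⟩ hφc.continuousOn
  set δ := φ zm.1 zm.2.1 zm.2.2 with hδ
  have hδpos : 0 < δ := hφpos _ hzm.1 _ _
  have hδle : ∀ z ∈ K, δ ≤ φ z.1 z.2.1 z.2.2 := fun z hz => hzmin hz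
  set M := W (1/2) 0 / φ (1/2) 0 0 with hM
  have hMpos : 0 < M := div_pos hWhalf (hφpos _ (hIcc _ hhalf) _ _)
  set c := M / 2 * δ with hc
  have hcpos : 0 < c := by positivity
  have hC1n : 0 ≤ C1 := le_trans (norm_nonneg _)
    (hC1 (1/2, 0) ⟨hIcc _ hhalf, ⟨le_rfl, hT.le⟩⟩)
  have hC2n : 0 ≤ C2 := le_trans (norm_nonneg _)
    (hC2 (1/2, 0) ⟨hIcc _ hhalf, ⟨le_rfl, hT.le⟩⟩)
  obtain ⟨α, hα⟩ : ∃ α : ℝ, α = C1 + 2 * C2 / c + 1 := ⟨_, rfl⟩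
  have hαpos : 0 < α := by rw [hα]; positivity
  obtain ⟨ε, hε⟩ : ∃ ε : ℝ, ε = M / 2 * Real.exp (-α) := ⟨_, rfl⟩
  have hεpos : 0 < ε := by rw [hε]; positivity
  have hεle : ∀ r ∈ Set.Icc (0:ℝ) 1, ε * Real.exp (α * r) ≤ M / 2 := by
    intro r hr
    rw [hε, mul_assoc, ← Real.exp_add]
    have : Real.exp (-α + α * r) ≤ 1 := Real.exp_le_one_iff.mpr (by nlinarith [hr.2])
    nlinarith
  obtain ⟨P, hPK, hPmax⟩ := hKcomp.exists_isMaxOn ⟨_, hKmem⟩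
    (f := fun z : ℝ × ℝ × ℝ => W z.1 z.2.2 / φ z.1 z.2.1 z.2.2 + ε * Real.exp (α * z.1)) (by
      rintro ⟨r, θ, t⟩ hz
      apply ContinuousAt.continuousWithinAt
      have a1 : ContinuousAt (fun z : ℝ × ℝ × ℝ => W z.1 z.2.2) (r, θ, t) :=
        ContinuousAt.comp (g := fun p : ℝ × ℝ => W p.1 p.2)
          (f := fun z : ℝ × ℝ × ℝ => (z.1, z.2.2)) (cW r hz.1 t).continuousAt (by fun_prop)
      have a2 := hφc.continuousAt (x := (r, θ, t))
      exact (a1.div a2 (hφpos r hz.1 θ t).ne').add (by fun_prop))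
  obtain ⟨r, θ, t⟩ := P
  have hrI : r ∈ Set.Icc (0:ℝ) 1 := hPK.1
  obtain ⟨M', hM'⟩ : ∃ x : ℝ, x = W r t / φ r θ t + ε * Real.exp (α * r) := ⟨_, rfl⟩
  have hglob : ∀ s ∈ Set.Icc (0:ℝ) 1, ∀ θ' t', W s t' / φ s θ' t' + ε * Real.exp (α * s) ≤ M' := by
    intro s hs θ' t'
    have pφ : Function.Periodic (fun x => φ s x t') (2 * π) := fun x => hφ2π s x t'
    obtain ⟨θ2, hθ2, e1⟩ := pφ.exists_mem_Ico₀ (by positivity) θ'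
    have pt : Function.Periodic (fun x => W s x / φ s θ2 x) T := fun x => by
      simp only [hWper, hφT]
    obtain ⟨t2, ht2, e2⟩ := pt.exists_mem_Ico₀ hT t'
    have e3 : W s t' / φ s θ' t' = W s t2 / φ s θ2 t2 := by
      have e1' : φ s θ' t' = φ s θ2 t' := e1
      rw [e1']; exact e2
    rw [e3, hM']
    exact hPmax (a := (s, θ2, t2)) ⟨hs, ⟨hθ2.1, hθ2.2.le⟩, ⟨ht2.1, ht2.2.le⟩⟩
  have hM'ge : M ≤ M' := by
    have := hglob (1/2) (hIcc _ hhalf) 0 0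
    have h2 : 0 < ε * Real.exp (α * (1/2)) := by positivity
    linarith
  obtain ⟨m, hm⟩ : ∃ m : ℝ → ℝ, m = fun s => M' - ε * Real.exp (α * s) := ⟨_, rfl⟩
  have hmge : ∀ s ∈ Set.Icc (0:ℝ) 1, M / 2 ≤ m s := by
    intro s hs; have := hεle s hs; rw [hm]; show _ ≤ M' - _; linarith
  have hmpos : 0 < m r := by have := hmge r hrI; linarith
  have hφP : 0 < φ r θ t := hφpos r hrI θ t
  have hWP : W r t = m r * φ r θ t := by
    have : m r = W r t / φ r θ t := by rw [hm]; show M' - _ = _; linarith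
    rw [this]; field_simp
  have hle : ∀ s ∈ Set.Icc (0:ℝ) 1, ∀ θ' t', W s t' - m s * φ s θ' t' ≤ 0 := by
    intro s hs θ' t'
    have h1 := hglob s hs θ' t'
    have h2 : W s t' / φ s θ' t' ≤ m s := by rw [hm]; show _ ≤ M' - _; linarith
    rw [div_le_iff₀ (hφpos s hs θ' t')] at h2
    linarith
  have hWPpos : 0 < W r t := by rw [hWP]; positivity
  have hr : r ∈ Set.Ioo (0:ℝ) 1 := by
    refine ⟨lt_of_le_of_ne hrI.1 ?_, lt_of_le_of_ne hrI.2 ?_⟩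
    · rintro rfl; rw [hW0] at hWPpos; exact lt_irrefl _ hWPpos
    · rintro rfl; rw [hW1] at hWPpos; exact lt_irrefl _ hWPpos
  have hWc : c ≤ W r t := by
    rw [hWP, hc]
    exact mul_le_mul (hmge r hrI) (hδle _ hPK) hδpos.le hmpos.le
  have hnear : ∀ᶠ s in nhds r, s ∈ Set.Ioo (0:ℝ) 1 := isOpen_Ioo.mem_nhds hr
  -- t derivative
  have hT0 : pdt W r t = m r * pdt3 φ r θ t := by
    have hmax : IsLocalMax (fun x => W r x - m r * φ r θ x) t := by
      refine Filter.Eventually.of_forall fun x => ?_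
      have := hle r hrI θ x
      show W r x - m r * φ r θ x ≤ W r t - m r * φ r θ t
      linarith
    have hd : HasDerivAt (fun x => W r x - m r * φ r θ x) (pdt W r t - m r * pdt3 φ r θ t) t :=
      (aux_t ((cW r hrI t).differentiableAt (by simp))).sub
        (((hφt r θ) t).hasDerivAt.const_mul (m r))
    linarith [hmax.hasDerivAt_eq_zero hd]
  -- theta derivatives
  have hφθ : ContDiff ℝ 2 (fun x => φ r x t) :=
    (hφ2 t).comp (contDiff_const.prodMk contDiff_id)
  have hφs : ContDiff ℝ 2 (fun x => φ x θ t) :=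
    (hφ2 t).comp (contDiff_id.prodMk contDiff_const)
  have hd1 : ∀ {g : ℝ → ℝ}, ContDiff ℝ 2 g → ∀ x, HasDerivAt g (deriv g x) x :=
    fun hg x => ((hg.differentiable (by simp)) x).hasDerivAt
  have hd2 : ∀ {g : ℝ → ℝ}, ContDiff ℝ 2 g → ∀ x, HasDerivAt (deriv g) (deriv (deriv g) x) x :=
    fun hg x => ((((contDiff_succ_iff_deriv (n := 1)).mp hg).2.2.differentiable (by simp)) x).hasDerivAt
  have hTh : pdh3 φ r θ t = 0 ∧ 0 ≤ pdh3 (fun a b c => pdh3 φ a b c) r θ t := by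
    have hmax : IsLocalMax (fun x => W r t - m r * φ r x t) θ := by
      refine Filter.Eventually.of_forall fun x => ?_
      have := hle r hrI x t
      show W r t - m r * φ r x t ≤ W r t - m r * φ r θ t
      linarith
    have := aux_sdt (y' := fun x => - (m r * deriv (fun x => φ r x t) x)) hmax
      (Filter.Eventually.of_forall fun s => ((hd1 hφθ s).const_mul (m r)).const_sub (W r t))
      ((hd2 hφθ θ).const_mul (m r)).neg
    obtain ⟨h1, h2⟩ := this
    constructor
    · have : m r * deriv (fun x => φ r x t) θ = 0 := by simpa using h1
      exact (mul_eq_zero.mp this).resolve_left hmpos.ne'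
    · have h3 : 0 ≤ m r * deriv (deriv (fun x => φ r x t)) θ := by linarith
      exact nonneg_of_mul_nonneg_right h3 hmpos
  -- r derivatives
  have hdm : ∀ s, HasDerivAt m (-(ε * Real.exp (α * s) * α)) s := by
    intro s
    have h1 : HasDerivAt (fun s => Real.exp (α * s)) (Real.exp (α * s) * (α * 1)) s :=
      ((hasDerivAt_id s).const_mul α).exp
    rw [hm]
    have := (h1.const_mul ε).const_sub M'
    refine this.congr_deriv ?_
    ring
  have hdm2 : HasDerivAt (fun s => -(ε * Real.exp (α * s) * α))
      (-(ε * Real.exp (α * r) * α * α)) r := by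
    have h1 : HasDerivAt (fun s => Real.exp (α * s)) (Real.exp (α * r) * (α * 1)) r :=
      ((hasDerivAt_id r).const_mul α).exp
    have := ((h1.const_mul ε).mul_const α).neg
    refine this.congr_deriv ?_
    ring
  have hdW : ∀ s ∈ Set.Ioo (0:ℝ) 1, HasDerivAt (fun x => W x t) (pdr W s t) s :=
    fun s hs => aux_r ((cW s (hIcc s hs) t).differentiableAt (by simp))
  have hdWr : HasDerivAt (fun x => pdr W x t) (pdr (pdr W) r t) r :=
    aux_r ((aux_pdr_cda (cW r hrI t) (m := 1) (by norm_num)).differentiableAt (by simp))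
  have hR := by
    have hmax : IsLocalMax (fun x => W x t - m x * φ x θ t) r := by
      filter_upwards [hnear] with x hx
      have := hle x (hIcc x hx) θ t
      linarith
    exact aux_sdt hmax
      (hnear.mono fun s hs => (hdW s hs).sub ((hdm s).mul (hd1 hφs s)))
      (hdWr.sub ((hdm2.mul (hd1 hφs r)).add ((hdm r).mul (hd2 hφs r))))
  obtain ⟨hR1, hR2⟩ := hR
  have hE := hEig r hr θ t
  have hA' : HasDerivAt (fun s => ψ s t / q s t) (pdr (fun s τ => ψ s τ / q s τ) r t) r := by
    refine aux_r (F := fun s τ => ψ s τ / q s τ) ?_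
    have : ContDiffAt ℝ 3 (fun p : ℝ × ℝ => ψ p.1 p.2 / q p.1 p.2) (r, t) :=
      ((cψ _).of_le (by norm_num)).div (hcq r hrI t) (hqne r hrI t)
    exact this.differentiableAt (by simp)
  have hLap : lapRev ψ χ φ r θ t = (1 / (ψ r t * q r t)) *
      (pdr (fun s τ => ψ s τ / q s τ) r t * deriv (fun x => φ x θ t) r
        + ψ r t / q r t * deriv (deriv (fun x => φ x θ t)) r)
      + (1 / (ψ r t) ^ 2) * pdh3 (fun a b c => pdh3 φ a b c) r θ t := by
    unfold lapRev
    have : pdr3 (fun s θ' τ => (ψ s τ / q s τ) * pdr3 φ s θ' τ) r θ t = _ :=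
      (hA'.mul (hd2 hφs r)).deriv
    rw [this]
  rw [hLap] at hE
  have hI := hIdent r hr t w hw
  refine aux_final (ψ r t) (q r t) (ψ r t / q r t) (pdr (fun s τ => ψ s τ / q s τ) r t)
    (W r t) (pdr W r t) (pdt W r t) (pdr (pdr W) r t) _
    (deriv (fun ξ => f t ξ (pdr u r t) 0) (u r t))
    (deriv (fun p => f t (u r t) p 0) (pdr u r t))
    (deriv (fun s => f t (u r t) (pdr u r t) s) 0)
    (φ r θ t) (deriv (fun x => φ x θ t) r) (pdt3 φ r θ t) (deriv (deriv (fun x => φ x θ t)) r)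
    (pdh3 φ r θ t) (pdh3 (fun a b c => pdh3 φ a b c) r θ t) (m r) (ε * Real.exp (α * r)) α lam
    C1 C2 c (hψpos r hrI t) (hqpos r hrI t) rfl hφP hmpos (by positivity) hαpos hcpos
    (hcond r hr t) hlam ?_ hE hWP hT0 hTh.1 hTh.2 hR1 ?_ hWc (hC1 (r, t) ⟨hrI, hPK.2.2⟩)
    (hC2 (r, t) ⟨hrI, hPK.2.2⟩) (by rw [hα]; linarith)
  · rw [hWt, hWrr, hWr, hW]
    simp only []
    rw [hI]
    ring
  · refine le_trans (le_of_eq ?_) hR2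
    ring
end

section
/- Let Ω ⊂ ℝⁿ be open, let f = f(t, ξ, p) : ℝ × ℝ × ℝⁿ → ℝ be C¹, and let u ∈ C³ satisfy ∂_t u = Δu + f(t, u, ∇u) on Ω × ℝ. For ε > 0 set w_ε := √(|∇u|² + ε²), m₀ := ∂f/∂ξ(t, u, ∇u), and X := ∇_p f(t, u, ∇u) ∈ ℝⁿ. Then pointwise on Ω × ℝ: ∂_t w_ε − Δ w_ε − ⟨X, ∇w_ε⟩ − m₀ w_ε ≤ − m₀ ε² / w_ε; in particular ∂_t w_ε − Δ w_ε − ⟨X, ∇w_ε⟩ − m₀ w_ε ≤ ε · sup |m₀|, whenever m₀ is bounded. -/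
open Real

/-- Partial derivative `∂u/∂x_i`. -/
noncomputable def pd {n : ℕ} (u : (Fin n → ℝ) → ℝ) (i : Fin n) (x : Fin n → ℝ) : ℝ :=
  fderiv ℝ u x (Pi.single i 1)

/-- Second partial derivative `∂²u/∂x_i∂x_j`. -/
noncomputable def pd2 {n : ℕ} (u : (Fin n → ℝ) → ℝ) (i j : Fin n) (x : Fin n → ℝ) : ℝ :=
  pd (fun y => pd u j y) i x

/-- The spatial gradient of `u(x,t)` at time `t`. -/
noncomputable def grd {n : ℕ} (u : (Fin n → ℝ) → ℝ → ℝ) (x : Fin n → ℝ) (t : ℝ) :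
    Fin n → ℝ :=
  fun i => pd (fun y => u y t) i x

/-- The regularized gradient norm `w_ε = √(|∇u|² + ε²)` of `u(x,t)`. -/
noncomputable def wEps {n : ℕ} (u : (Fin n → ℝ) → ℝ → ℝ) (ε : ℝ) (y : Fin n → ℝ)
    (t : ℝ) : ℝ :=
  Real.sqrt ((∑ j, (grd u y t j) ^ 2) + ε ^ 2)

noncomputable def DD {n : ℕ} (v : (Fin n → ℝ) × ℝ) (G : (Fin n → ℝ) × ℝ → ℝ)
    (q : (Fin n → ℝ) × ℝ) : ℝ := fderiv ℝ G q v

lemma DD_hd {n : ℕ} (v : (Fin n → ℝ) × ℝ) {G : (Fin n → ℝ) × ℝ → ℝ}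
    {q : (Fin n → ℝ) × ℝ} (h : DifferentiableAt ℝ G q) :
    HasDerivAt (fun s : ℝ => G (q + s • v)) (DD v G q) 0 :=
  h.hasFDerivAt.hasLineDerivAt v

lemma DD_eq {n : ℕ} (v : (Fin n → ℝ) × ℝ) {G : (Fin n → ℝ) × ℝ → ℝ}
    {q : (Fin n → ℝ) × ℝ} (h : DifferentiableAt ℝ G q) {a : ℝ}
    (ha : HasDerivAt (fun s : ℝ => G (q + s • v)) a 0) : DD v G q = a :=
  (DD_hd v h).unique ha

lemma DD_contDiff {n : ℕ} (v : (Fin n → ℝ) × ℝ) {G : (Fin n → ℝ) × ℝ → ℝ} {k m : WithTop ℕ∞}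
    (h : ContDiff ℝ k G) (hk : m + 1 ≤ k) : ContDiff ℝ m (DD v G) :=
  (h.fderiv_right hk).clm_apply contDiff_const

lemma DD_comm {n : ℕ} (v w : (Fin n → ℝ) × ℝ) {G : (Fin n → ℝ) × ℝ → ℝ}
    (h : ContDiff ℝ 2 G) : DD v (DD w G) = DD w (DD v G) := by
  funext q
  have hs : IsSymmSndFDerivAt ℝ G q :=
    h.contDiffAt.isSymmSndFDerivAt (by simp)
  have hd : DifferentiableAt ℝ (fderiv ℝ G) q :=
    ((h.fderiv_right (m := 1) (by norm_num)).differentiable (by norm_num)) q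
  have key : ∀ a b : (Fin n → ℝ) × ℝ, DD a (DD b G) q = fderiv ℝ (fderiv ℝ G) q a b := by
    intro a b
    unfold DD
    rw [fderiv_clm_apply hd (by fun_prop)]
    simp
  rw [key, key]
  exact hs v w

lemma pd_eq {n : ℕ} {G : (Fin n → ℝ) × ℝ → ℝ} (h : Differentiable ℝ G) (i : Fin n)
    (x : Fin n → ℝ) (t : ℝ) :
    pd (fun y => G (y, t)) i x = DD (Pi.single i 1, 0) G (x, t) := by
  unfold pd DD
  have h1 : HasFDerivAt (fun y : Fin n → ℝ => (y, t)) (ContinuousLinearMap.inl ℝ (Fin n → ℝ) ℝ) x :=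
    hasFDerivAt_prodMk_left x t
  have := (h (x, t)).hasFDerivAt.comp x h1
  have h2 := this.fderiv
  simp only [Function.comp_def] at h2
  rw [h2]; simp

lemma dt_eq {n : ℕ} {G : (Fin n → ℝ) × ℝ → ℝ} (h : Differentiable ℝ G)
    (x : Fin n → ℝ) (t : ℝ) :
    deriv (fun s => G (x, s)) t = DD (0, 1) G (x, t) := by
  unfold DD
  have h1 : HasFDerivAt (fun s : ℝ => (x, s)) (ContinuousLinearMap.inr ℝ (Fin n → ℝ) ℝ) t :=
    hasFDerivAt_prodMk_right x t
  have := ((h (x, t)).hasFDerivAt.comp t h1).hasDerivAt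
  have h2 := this.deriv
  simp only [Function.comp_def] at h2
  rw [h2]; simp

lemma fp_eq {n : ℕ} {F : ℝ × ℝ × (Fin n → ℝ) → ℝ} (h : Differentiable ℝ F)
    (t ξ : ℝ) (p v : Fin n → ℝ) :
    fderiv ℝ (fun p => F (t, ξ, p)) p v = fderiv ℝ F (t, ξ, p) (0, 0, v) := by
  have h1 : HasFDerivAt (fun p : Fin n → ℝ => (t, ξ, p))
    ((ContinuousLinearMap.inr ℝ ℝ (ℝ × (Fin n → ℝ))).comp
      (ContinuousLinearMap.inr ℝ ℝ (Fin n → ℝ))) p :=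
    (hasFDerivAt_prodMk_right t (ξ, p)).comp p (hasFDerivAt_prodMk_right ξ p)
  have h2 := ((h (t, ξ, p)).hasFDerivAt.comp p h1).fderiv
  simp only [Function.comp_def] at h2
  rw [h2]; simp

lemma fxi_eq {n : ℕ} {F : ℝ × ℝ × (Fin n → ℝ) → ℝ} (h : Differentiable ℝ F)
    (t ξ : ℝ) (p : Fin n → ℝ) :
    deriv (fun ξ => F (t, ξ, p)) ξ = fderiv ℝ F (t, ξ, p) (0, 1, 0) := by
  have h1 : HasFDerivAt (fun ξ : ℝ => (t, ξ, p))
    ((ContinuousLinearMap.inr ℝ ℝ (ℝ × (Fin n → ℝ))).comp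
      (ContinuousLinearMap.inl ℝ ℝ (Fin n → ℝ))) ξ :=
    (hasFDerivAt_prodMk_right t (ξ, p)).comp ξ (hasFDerivAt_prodMk_left ξ p)
  have h2 := ((h (t, ξ, p)).hasFDerivAt.comp ξ h1).hasDerivAt.deriv
  simp only [Function.comp_def] at h2
  rw [h2]; simp

noncomputable def WW {n : ℕ} (g : Fin n → (Fin n → ℝ) × ℝ → ℝ) (ε : ℝ)
    (q : (Fin n → ℝ) × ℝ) : ℝ := Real.sqrt ((∑ j, (g j q) ^ 2) + ε ^ 2)

section
variable {n : ℕ} {g : Fin n → (Fin n → ℝ) × ℝ → ℝ} {ε : ℝ}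

lemma SS_pos (hε : 0 < ε) (q) : 0 < (∑ j, (g j q) ^ 2) + ε ^ 2 := by positivity

lemma WW_contDiff (hg : ∀ j, ContDiff ℝ 2 (g j)) (hε : 0 < ε) : ContDiff ℝ 2 (WW g ε) := by
  unfold WW
  apply ContDiff.sqrt
  · exact (ContDiff.sum fun j _ => (hg j).pow 2).add contDiff_const
  · intro q; exact (SS_pos hε q).ne'

lemma DD_WW (hg : ∀ j, ContDiff ℝ 2 (g j)) (hε : 0 < ε) (v q) :
    DD v (WW g ε) q = (∑ j, g j q * DD v (g j) q) / WW g ε q := by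
  apply DD_eq v ((WW_contDiff hg hε).differentiable (by norm_num) q)
  have h0 : HasDerivAt (fun s : ℝ => (∑ j, (g j (q + s • v)) ^ 2) + ε ^ 2)
      (∑ j, 2 * (g j q * DD v (g j) q)) 0 := by
    apply HasDerivAt.add_const
    apply HasDerivAt.fun_sum
    intro j _
    have := (DD_hd v ((hg j).differentiable (by norm_num) q)).fun_pow 2
    refine this.congr_deriv ?_
    simp; ring
  have h1 := h0.sqrt (by simpa using (SS_pos hε q).ne')
  refine h1.congr_deriv ?_
  symm
  simp only [WW, zero_smul, add_zero, ← Finset.mul_sum]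
  rw [mul_div_mul_left _ _ two_ne_zero]

lemma DD2_WW (hg : ∀ j, ContDiff ℝ 2 (g j)) (hε : 0 < ε) (v q) :
    DD v (DD v (WW g ε)) q =
      ((∑ j, (DD v (g j) q) ^ 2) + ∑ j, g j q * DD v (DD v (g j)) q) / WW g ε q
        - (∑ j, g j q * DD v (g j) q) ^ 2 / WW g ε q ^ 3 := by
  have hW : WW g ε q ≠ 0 := (Real.sqrt_pos.2 (SS_pos hε q)).ne'
  have hWc := WW_contDiff hg hε
  apply DD_eq v ((DD_contDiff (m := 1) v hWc (by norm_num)).differentiable (by norm_num) q)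
  have e : (fun s : ℝ => DD v (WW g ε) (q + s • v)) = fun s : ℝ =>
      (∑ j, g j (q + s • v) * DD v (g j) (q + s • v)) / WW g ε (q + s • v) := by
    funext s; exact DD_WW hg hε v _
  rw [e]
  have h0 : HasDerivAt (fun s : ℝ => ∑ j, g j (q + s • v) * DD v (g j) (q + s • v))
      (∑ j, ((DD v (g j) q) ^ 2 + g j q * DD v (DD v (g j)) q)) 0 := by
    apply HasDerivAt.fun_sum
    intro j _
    have := (DD_hd v ((hg j).differentiable (by norm_num) q)).fun_mul
      (DD_hd v ((DD_contDiff (m := 1) v (hg j) (by norm_num)).differentiable (by norm_num) q))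
    refine this.congr_deriv ?_
    simp; ring
  have h1 := h0.fun_div (DD_hd v (hWc.differentiable (by norm_num) q)) (by simpa using hW)
  refine h1.congr_deriv ?_
  symm
  simp only [zero_smul, add_zero, DD_WW hg hε v q, Finset.sum_add_distrib]
  field_simp

lemma DD2_WW_ge (hg : ∀ j, ContDiff ℝ 2 (g j)) (hε : 0 < ε) (v q) :
    (∑ j, g j q * DD v (DD v (g j)) q) / WW g ε q ≤ DD v (DD v (WW g ε)) q := by
  have hW : 0 < WW g ε q := Real.sqrt_pos.2 (SS_pos hε q)
  have hW2 : WW g ε q ^ 2 = (∑ j, (g j q) ^ 2) + ε ^ 2 := Real.sq_sqrt (SS_pos hε q).le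
  rw [DD2_WW hg hε]
  have cs := Finset.sum_mul_sq_le_sq_mul_sq Finset.univ (fun j => g j q) (fun j => DD v (g j) q)
  have hB : 0 ≤ ∑ j, (DD v (g j) q) ^ 2 := by positivity
  have : (∑ j, g j q * DD v (g j) q) ^ 2 / WW g ε q ^ 3 ≤ (∑ j, (DD v (g j) q) ^ 2) / WW g ε q := by
    rw [div_le_div_iff₀ (by positivity) hW]
    have : (∑ j, g j q * DD v (g j) q) ^ 2 ≤ (∑ j, (DD v (g j) q) ^ 2) * WW g ε q ^ 2 := by
      rw [hW2]; nlinarith [mul_nonneg hB (sq_nonneg ε)]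
    nlinarith
  rw [add_div]; linarith
end

lemma chain_F {n : ℕ} {F : ℝ × ℝ × (Fin n → ℝ) → ℝ} (h : Differentiable ℝ F)
    {U : (Fin n → ℝ) × ℝ → ℝ} {g : Fin n → (Fin n → ℝ) × ℝ → ℝ}
    (hU : Differentiable ℝ U) (hg : ∀ j, Differentiable ℝ (g j)) (j : Fin n) (q) :
    DD (Pi.single j 1, 0) (fun q => F (q.2, U q, fun k => g k q)) q
      = fderiv ℝ F (q.2, U q, fun k => g k q) (0, 1, 0) * DD (Pi.single j 1, 0) U q
        + ∑ k, fderiv ℝ F (q.2, U q, fun k => g k q) (0, 0, Pi.single k 1)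
            * DD (Pi.single j 1, 0) (g k) q := by
  have hin := (hasFDerivAt_snd (𝕜 := ℝ) (p := q)).prodMk ((hU q).hasFDerivAt.prodMk
    (hasFDerivAt_pi.2 fun k => (hg k q).hasFDerivAt))
  have h2 := ((h (q.2, U q, fun k => g k q)).hasFDerivAt.comp q hin).fderiv
  simp only [Function.comp_def] at h2
  unfold DD
  rw [h2]
  set L := fderiv ℝ F (q.2, U q, fun k => g k q)
  set v : (Fin n → ℝ) × ℝ := (Pi.single j 1, 0)
  have hv : ((0 : ℝ), fderiv ℝ U q v, fun k => fderiv ℝ (g k) q v)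
      = (fderiv ℝ U q v) • ((0 : ℝ), (1 : ℝ), (0 : Fin n → ℝ))
        + ∑ k, (fderiv ℝ (g k) q v) • ((0 : ℝ), (0 : ℝ), (Pi.single k 1 : Fin n → ℝ)) := by
    refine Prod.ext ?_ (Prod.ext ?_ ?_)
    · simp [Prod.fst_sum]
    · simp [Prod.fst_sum, Prod.snd_sum]
    · funext k
      simp [Prod.snd_sum, Finset.sum_apply, Pi.single_apply]
  trans L ((0 : ℝ), fderiv ℝ U q v, fun k => fderiv ℝ (g k) q v)
  · rfl
  · rw [hv, map_add, map_sum, map_smul]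
    simp only [map_smul, smul_eq_mul, mul_comm]

/-- Euclidean case of inequality (22): if `u` solves
`∂_t u = Δu + f(t,u,∇u)`, then with `w_ε = √(|∇u|²+ε²)`, `m₀ = f_ξ(t,u,∇u)` and
`X = ∇_p f(t,u,∇u)` one has
`∂_t w_ε − Δw_ε − ⟨X,∇w_ε⟩ − m₀ w_ε ≤ −m₀ ε²/w_ε ≤ ε·sup|m₀|`. -/
theorem stmt_12 (n : ℕ) (Ω : Set (Fin n → ℝ)) (hΩ : IsOpen Ω)
    (f : ℝ → ℝ → (Fin n → ℝ) → ℝ)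
    (hf : ContDiff ℝ 1 fun q : ℝ × ℝ × (Fin n → ℝ) => f q.1 q.2.1 q.2.2)
    (u : (Fin n → ℝ) → ℝ → ℝ)
    (hu : ContDiff ℝ 3 fun q : (Fin n → ℝ) × ℝ => u q.1 q.2)
    (hPDE : ∀ x ∈ Ω, ∀ t : ℝ,
      deriv (fun s => u x s) t
        = (∑ i, pd2 (fun y => u y t) i i x) + f t (u x t) (grd u x t))
    (ε : ℝ) (hε : 0 < ε) :
    ∀ x ∈ Ω, ∀ t : ℝ,
      (deriv (fun s => wEps u ε x s) t
          - (∑ i, pd2 (fun y => wEps u ε y t) i i x)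
          - (∑ i, fderiv ℝ (fun p => f t (u x t) p) (grd u x t) (Pi.single i 1)
              * pd (fun y => wEps u ε y t) i x)
          - deriv (fun ξ => f t ξ (grd u x t)) (u x t) * wEps u ε x t
        ≤ -(deriv (fun ξ => f t ξ (grd u x t)) (u x t)) * ε ^ 2 / wEps u ε x t)
      ∧ (∀ C : ℝ,
          (∀ x' ∈ Ω, ∀ t' : ℝ, |deriv (fun ξ => f t' ξ (grd u x' t')) (u x' t')| ≤ C) →
          deriv (fun s => wEps u ε x s) t
              - (∑ i, pd2 (fun y => wEps u ε y t) i i x)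
              - (∑ i, fderiv ℝ (fun p => f t (u x t) p) (grd u x t) (Pi.single i 1)
                  * pd (fun y => wEps u ε y t) i x)
              - deriv (fun ξ => f t ξ (grd u x t)) (u x t) * wEps u ε x t
            ≤ ε * C) := by
  set U : (Fin n → ℝ) × ℝ → ℝ := fun q => u q.1 q.2 with hUdef
  set F : ℝ × ℝ × (Fin n → ℝ) → ℝ := fun q => f q.1 q.2.1 q.2.2 with hFdef
  set e : Fin n → (Fin n → ℝ) × ℝ := fun i => (Pi.single i 1, 0) with he
  set g : Fin n → (Fin n → ℝ) × ℝ → ℝ := fun j => DD (e j) U with hgdef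
  have hg : ∀ j, ContDiff ℝ 2 (g j) := fun j => DD_contDiff _ hu (by norm_num)
  have hFd : Differentiable ℝ F := hf.differentiable (by norm_num)
  have hUd : Differentiable ℝ U := hu.differentiable (by norm_num)
  have hgd : ∀ j, Differentiable ℝ (g j) := fun j => (hg j).differentiable (by norm_num)
  have hg1 : ∀ v j, ContDiff ℝ 1 (DD v (g j)) := fun v j => DD_contDiff _ (hg j) (by norm_num)
  have hg1d : ∀ v j, Differentiable ℝ (DD v (g j)) :=
    fun v j => (hg1 v j).differentiable (by norm_num)
  have hu2 : ContDiff ℝ 2 U := hu.of_le (by norm_num)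
  have hgrd : ∀ x t, grd u x t = fun j => g j (x, t) := by
    intro x t; funext j; exact pd_eq hUd j x t
  have hw : ∀ x t, wEps u ε x t = WW g ε (x, t) := by
    intro x t; simp only [wEps, WW, hgrd]
  have hWc : ContDiff ℝ 2 (WW g ε) := WW_contDiff hg hε
  have hWd : Differentiable ℝ (WW g ε) := hWc.differentiable (by norm_num)
  have hpd2 : ∀ {G : (Fin n → ℝ) × ℝ → ℝ}, ContDiff ℝ 2 G → ∀ i x t,
      pd2 (fun y => G (y, t)) i i x = DD (e i) (DD (e i) G) (x, t) := by
    intro G hG i x t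
    unfold pd2
    have : (fun y => pd (fun y => G (y, t)) i y) = fun y => DD (e i) G (y, t) := by
      funext y; exact pd_eq (hG.differentiable (by norm_num)) i y t
    rw [this]
    exact pd_eq ((DD_contDiff (m := 1) _ hG (by norm_num)).differentiable (by norm_num)) i x t
  have hP : ∀ q : (Fin n → ℝ) × ℝ, q.1 ∈ Ω →
      DD (0, 1) U q = (∑ i, DD (e i) (g i) q) + F (q.2, U q, fun k => g k q) := by
    rintro ⟨x, t⟩ hx
    have h := hPDE x hx t
    have h1 := dt_eq hUd x t
    have h2 := fun i => hpd2 hu2 i x t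
    simp only [hUdef] at h1 h2
    rw [h1, hgrd] at h
    simp only [h2] at h
    exact h
  intro x hx t
  set q : (Fin n → ℝ) × ℝ := (x, t) with hq
  set m₀ := fderiv ℝ F (t, U q, fun k => g k q) (0, 1, 0) with hm
  set X : Fin n → ℝ := fun i => fderiv ℝ F (t, U q, fun k => g k q) (0, 0, Pi.single i 1) with hX
  have hm0 : ∀ x t, deriv (fun ξ => f t ξ (grd u x t)) (u x t)
      = fderiv ℝ F (t, U (x, t), fun k => g k (x, t)) (0, 1, 0) := by
    intro x t
    rw [hgrd]; exact fxi_eq hFd t (u x t) _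
  have hXi : ∀ i, fderiv ℝ (fun p => f t (u x t) p) (grd u x t) (Pi.single i 1) = X i := by
    intro i
    rw [hgrd]; exact fp_eq hFd t (u x t) _ _
  -- differentiated equation
  have hD : ∀ j, DD (0, 1) (g j) q = (∑ i, DD (e i) (DD (e i) (g j)) q)
      + (m₀ * g j q + ∑ k, X k * DD (e k) (g j) q) := by
    intro j
    have hev : DD (0, 1) U =ᶠ[nhds q]
        fun q => (∑ i, DD (e i) (g i) q) + F (q.2, U q, fun k => g k q) := by
      have : ∀ᶠ q' : (Fin n → ℝ) × ℝ in nhds q, q'.1 ∈ Ω :=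
        continuous_fst.continuousAt.eventually (hΩ.mem_nhds hx)
      filter_upwards [this] with q' hq'
      exact hP q' hq'
    have h1 : DD (e j) (DD (0, 1) U) q = DD (e j) (fun q => (∑ i, DD (e i) (g i) q)
        + F (q.2, U q, fun k => g k q)) q := by
      unfold DD at hev ⊢
      rw [hev.fderiv_eq]
    have hFc : Differentiable ℝ (fun q : (Fin n → ℝ) × ℝ => F (q.2, U q, fun k => g k q)) :=
      hFd.comp (differentiable_snd.prodMk (hUd.prodMk (differentiable_pi.2 hgd)))
    have h2 : DD (e j) (fun q => (∑ i, DD (e i) (g i) q)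
        + F (q.2, U q, fun k => g k q)) q
        = (∑ i, DD (e j) (DD (e i) (g i)) q)
          + DD (e j) (fun q => F (q.2, U q, fun k => g k q)) q := by
      apply DD_eq
      · exact (Differentiable.fun_sum fun i _ => hg1d (e i) i).add hFc q
      · exact (HasDerivAt.fun_sum fun i _ => DD_hd (e j) (hg1d (e i) i q)).add
          (DD_hd (e j) (hFc q))
    have hc : ∀ k, DD (e j) (g k) = DD (e k) (g j) := fun k => DD_comm _ _ hu2
    rw [DD_comm _ _ hu2] at h1
    rw [show DD (0, 1) (g j) q = _ from h1, h2, chain_F hFd hUd hgd j q]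
    congr 1
    · refine Finset.sum_congr rfl fun i _ => ?_
      rw [DD_comm _ _ (hg i), hc i]
    · congr 1
      refine Finset.sum_congr rfl fun k _ => ?_
      rw [← hc k]
  have hW : 0 < WW g ε q := Real.sqrt_pos.2 (SS_pos hε q)
  have hW2 : WW g ε q ^ 2 = (∑ j, (g j q) ^ 2) + ε ^ 2 := Real.sq_sqrt (SS_pos hε q).le
  have main : DD (0, 1) (WW g ε) q - (∑ i, DD (e i) (DD (e i) (WW g ε)) q)
      - (∑ i, X i * DD (e i) (WW g ε) q) - m₀ * WW g ε q ≤ -m₀ * ε ^ 2 / WW g ε q := by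
    have h1 := Finset.sum_le_sum fun i (_ : i ∈ Finset.univ) => DD2_WW_ge hg hε (e i) q
    have h2 : DD (0, 1) (WW g ε) q = (∑ i, (∑ j, g j q * DD (e i) (DD (e i) (g j)) q) / WW g ε q)
        + (∑ i, X i * DD (e i) (WW g ε) q) + m₀ * (∑ j, (g j q) ^ 2) / WW g ε q := by
      simp only [DD_WW hg hε, hD, ← mul_div_assoc, ← Finset.sum_div, ← add_div]
      congr 1
      simp only [mul_add, Finset.sum_add_distrib, Finset.mul_sum]
      rw [Finset.sum_comm, add_assoc]
      congr 1
      rw [add_comm]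
      congr 1
      · rw [Finset.sum_comm]
        refine Finset.sum_congr rfl fun i _ => Finset.sum_congr rfl fun k _ => ?_
        ring
      · refine Finset.sum_congr rfl fun i _ => ?_
        ring
    have h3 : m₀ * (∑ j, (g j q) ^ 2) / WW g ε q - m₀ * WW g ε q = -m₀ * ε ^ 2 / WW g ε q := by
      field_simp
      rw [hW2]; ring
    linarith
  have r1 : deriv (fun s => wEps u ε x s) t = DD (0, 1) (WW g ε) q := by
    simp only [hw]; exact dt_eq hWd x t
  have r2 : ∀ i, pd2 (fun y => wEps u ε y t) i i x = DD (e i) (DD (e i) (WW g ε)) q := by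
    intro i; simp only [hw]; exact hpd2 hWc i x t
  have r3 : ∀ i, pd (fun y => wEps u ε y t) i x = DD (e i) (WW g ε) q := by
    intro i; simp only [hw]; exact pd_eq hWd i x t
  have r4 : deriv (fun ξ => f t ξ (grd u x t)) (u x t) = m₀ := hm0 x t
  simp only [r1, r2, r3, hXi, hw x t]
  rw [r4]
  refine ⟨main, fun C hC => main.trans ?_⟩
  have hC' := hC x hx t
  rw [r4] at hC'
  have hC0 : 0 ≤ C := (abs_nonneg _).trans hC'
  have hεW : ε ≤ WW g ε q := Real.le_sqrt_of_sq_le (by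
    have : 0 ≤ ∑ j, (g j q) ^ 2 := by positivity
    linarith)
  rw [div_le_iff₀ hW]
  have a1 : -m₀ ≤ C := (neg_le_abs m₀).trans hC'
  calc -m₀ * ε ^ 2 ≤ C * ε ^ 2 := by gcongr
    _ = ε * C * ε := by ring
    _ ≤ ε * C * WW g ε q := by gcongr
end
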